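/- arXiv:2004.11878 — 4 statements merged into one kernel-verified Lean document; each statement's English description precedes it below -/
import Mathlib

section
/- Fix n ≥ 1, k ∈ (0,1), θ > 0, and let Y_1,…,Y_n be i.i.d. uniform on [θ(1−k), θ(1+k)]. Define c^± = (1/2)(1 ± k)/(1 + k²(n−1)/(n+1)). Then the estimator θ̂_LV = c^− Y_(1) + c^+ Y_(n) is unbiased: E[c^− min_i Y_i + c^+ max_i Y_i] = θ. -/
open MeasureTheory

/-- The uniform probability distribution on the interval `[a, b]`. -/
noncomputable def unifIcc (a b : ℝ) : Measure ℝ :=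
  (ENNReal.ofReal (b - a))⁻¹ • volume.restrict (Set.Icc a b)

/-- If `X` has tail `ν {t ≤ X} = ((L - t) / L) ^ n` on `[0, L]` with `n ≥ 1`, then `X` is
integrable with mean `L / (n + 1)`. -/
theorem integrable_and_integral_eq_of_tail {Ω : Type*} [MeasurableSpace Ω] (ν : Measure Ω)
    [IsProbabilityMeasure ν] {X : Ω → ℝ} (hX : Measurable X) {L : ℝ} (hL : 0 < L) {n : ℕ}
    (hn : 1 ≤ n)
    (h : ∀ t, 0 ≤ t → t ≤ L → ν {ω | t ≤ X ω} = ENNReal.ofReal ((L - t) / L) ^ n) :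
    Integrable X ν ∧ ∫ ω, X ω ∂ν = L / (n + 1) := by
  have hnonneg : ∀ᵐ ω ∂ν, 0 ≤ X ω := by
    refine (prob_compl_eq_zero_iff (measurableSet_le measurable_const hX)).2 ?_
    simp [h 0 le_rfl hL.le, hL.ne']
  have hle : ∀ᵐ ω ∂ν, X ω ≤ L := by
    have h0 : ν {ω | L ≤ X ω} = 0 := by
      rw [h L hL.le le_rfl]
      simp [show n ≠ 0 by omega]
    refine measure_mono_null (fun ω hω => ?_) h0
    exact (le_total L (X ω)).resolve_right hω
  have hint : Integrable X ν :=
    Integrable.of_mem_Icc 0 L hX.aemeasurable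
      (by filter_upwards [hnonneg, hle] with ω h0 h1 using ⟨h0, h1⟩)
  refine ⟨hint, ?_⟩
  rw [hint.integral_eq_integral_Ioc_meas_le hnonneg hle,
    ← intervalIntegral.integral_of_le hL.le]
  have hcongr : ∫ t in (0:ℝ)..L, ν.real {ω | t ≤ X ω} = ∫ t in (0:ℝ)..L, ((L - t) / L) ^ n := by
    refine intervalIntegral.integral_congr fun t ht => ?_
    rw [Set.uIcc_of_le hL.le] at ht
    have : 0 ≤ (L - t) / L := div_nonneg (by linarith [ht.2]) hL.le
    simp [Measure.real, h t ht.1 ht.2, ENNReal.toReal_ofReal this]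
  rw [hcongr, intervalIntegral.integral_comp_sub_left (fun u => (u / L) ^ n) L]
  simp only [div_pow, sub_self, sub_zero, intervalIntegral.integral_div, integral_pow]
  field_simp
  simp [pow_succ]

theorem unifIcc_Ici {a b t : ℝ} (hab : a < b) (h0 : 0 ≤ t) :
    unifIcc a b (Set.Ici (a + t)) = ENNReal.ofReal ((b - a - t) / (b - a)) := by
  have hs : Set.Ici (a + t) ∩ Set.Icc a b = Set.Icc (a + t) b := by
    ext x
    simp only [Set.mem_inter_iff, Set.mem_Ici, Set.mem_Icc]
    exact ⟨fun h => ⟨h.1, h.2.2⟩, fun h => ⟨h.1, by linarith [h.1], h.2⟩⟩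
  rw [unifIcc, Measure.smul_apply, Measure.restrict_apply measurableSet_Ici, hs, Real.volume_Icc,
    ENNReal.ofReal_div_of_pos (sub_pos.2 hab), smul_eq_mul, mul_comm, ← div_eq_mul_inv,
    sub_add_eq_sub_sub]

theorem unifIcc_Iic {a b t : ℝ} (hab : a < b) (h0 : 0 ≤ t) :
    unifIcc a b (Set.Iic (b - t)) = ENNReal.ofReal ((b - a - t) / (b - a)) := by
  have hs : Set.Iic (b - t) ∩ Set.Icc a b = Set.Icc a (b - t) := by
    ext x
    simp only [Set.mem_inter_iff, Set.mem_Iic, Set.mem_Icc]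
    exact ⟨fun h => ⟨h.2.1, h.1⟩, fun h => ⟨h.2, h.1, by linarith [h.2]⟩⟩
  rw [unifIcc, Measure.smul_apply, Measure.restrict_apply measurableSet_Iic, hs, Real.volume_Icc,
    ENNReal.ofReal_div_of_pos (sub_pos.2 hab), smul_eq_mul, mul_comm, ← div_eq_mul_inv,
    sub_right_comm]

theorem isProbabilityMeasure_unifIcc {a b : ℝ} (hab : a < b) :
    IsProbabilityMeasure (unifIcc a b) := by
  constructor
  rw [unifIcc, Measure.smul_apply, Measure.restrict_apply_univ, Real.volume_Icc, smul_eq_mul]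
  exact ENNReal.inv_mul_cancel (by simpa using hab) ENNReal.ofReal_ne_top

theorem integral_iInf_pi_unifIcc {n : ℕ} (hn : 1 ≤ n) {a b : ℝ} (hab : a < b) :
    Integrable (fun y : Fin n → ℝ => ⨅ i, y i) (Measure.pi fun _ => unifIcc a b) ∧
      ∫ y : Fin n → ℝ, ⨅ i, y i ∂(Measure.pi fun _ => unifIcc a b) = a + (b - a) / (n + 1) := by
  have := isProbabilityMeasure_unifIcc hab
  have : Nonempty (Fin n) := ⟨⟨0, hn⟩⟩
  obtain ⟨hint, hmean⟩ := integrable_and_integral_eq_of_tail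
    (Measure.pi fun _ : Fin n => unifIcc a b) (X := fun y => (⨅ i, y i) - a)
    ((Measurable.iInf measurable_pi_apply).sub_const a) (sub_pos.2 hab) hn (fun t h0 _ => by
      have hs : {y : Fin n → ℝ | t ≤ (⨅ i, y i) - a} =
          Set.univ.pi fun _ => Set.Ici (a + t) := by
        ext y
        simp [le_sub_iff_add_le', le_ciInf_iff (Set.finite_range y).bddBelow, Pi.le_def]
      rw [hs, Measure.pi_pi]
      simp [unifIcc_Ici hab h0])
  have hint' : Integrable (fun y : Fin n → ℝ => ⨅ i, y i) (Measure.pi fun _ => unifIcc a b) := by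
    exact (hint.add (integrable_const a)).congr (ae_of_all _ fun y => sub_add_cancel _ _)
  refine ⟨hint', ?_⟩
  rw [integral_sub hint' (integrable_const a)] at hmean
  simp only [integral_const, probReal_univ, one_smul] at hmean
  linarith

theorem integral_iSup_pi_unifIcc {n : ℕ} (hn : 1 ≤ n) {a b : ℝ} (hab : a < b) :
    Integrable (fun y : Fin n → ℝ => ⨆ i, y i) (Measure.pi fun _ => unifIcc a b) ∧
      ∫ y : Fin n → ℝ, ⨆ i, y i ∂(Measure.pi fun _ => unifIcc a b) = b - (b - a) / (n + 1) := by
  have := isProbabilityMeasure_unifIcc hab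
  have : Nonempty (Fin n) := ⟨⟨0, hn⟩⟩
  obtain ⟨hint, hmean⟩ := integrable_and_integral_eq_of_tail
    (Measure.pi fun _ : Fin n => unifIcc a b) (X := fun y => b - ⨆ i, y i)
    ((Measurable.iSup measurable_pi_apply).const_sub b) (sub_pos.2 hab) hn (fun t h0 _ => by
      have hs : {y : Fin n → ℝ | t ≤ b - ⨆ i, y i} =
          Set.univ.pi fun _ => Set.Iic (b - t) := by
        ext y
        simp [le_sub_comm (a := t), ciSup_le_iff (Set.finite_range y).bddAbove, Pi.le_def]
      rw [hs, Measure.pi_pi]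
      simp [unifIcc_Iic hab h0])
  have hint' : Integrable (fun y : Fin n → ℝ => ⨆ i, y i) (Measure.pi fun _ => unifIcc a b) := by
    exact ((integrable_const b).sub hint).congr (ae_of_all _ fun y => sub_sub_cancel _ _)
  refine ⟨hint', ?_⟩
  rw [integral_sub (integrable_const b) hint'] at hmean
  simp only [integral_const, probReal_univ, one_smul] at hmean
  linarith

/-- With `c^± = (1/2)(1 ± k)/(1 + k²(n-1)/(n+1))`, the estimator
`θ̂_LV = c⁻ Y_(1) + c⁺ Y_(n)` is unbiased for the scale parameter `θ`:
`E[c⁻ min_i Y_i + c⁺ max_i Y_i] = θ`. -/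
theorem stmt_4 (n : ℕ) (hn : 1 ≤ n) (k : ℝ) (hk : k ∈ Set.Ioo (0:ℝ) 1)
    (θ : ℝ) (hθ : 0 < θ) :
    (∫ y : Fin n → ℝ,
        ((1/2) * (1 - k) / (1 + k^2 * (n - 1) / (n + 1)) * (⨅ i, y i)
          + (1/2) * (1 + k) / (1 + k^2 * (n - 1) / (n + 1)) * (⨆ i, y i))
      ∂(Measure.pi fun _ : Fin n => unifIcc (θ * (1 - k)) (θ * (1 + k)))) = θ := by
  obtain ⟨hk0, -⟩ := hk
  have hab : θ * (1 - k) < θ * (1 + k) := mul_lt_mul_of_pos_left (by linarith) hθ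
  obtain ⟨hinf, hinf_mean⟩ := integral_iInf_pi_unifIcc hn hab
  obtain ⟨hsup, hsup_mean⟩ := integral_iSup_pi_unifIcc hn hab
  rw [integral_add (hinf.const_mul _) (hsup.const_mul _), integral_const_mul, integral_const_mul,
    hinf_mean, hsup_mean]
  have hn' : (1 : ℝ) ≤ n := by exact_mod_cast hn
  have hD : 0 < 1 + k ^ 2 * ((n : ℝ) - 1) / (n + 1) := by
    have : 0 ≤ k ^ 2 * ((n : ℝ) - 1) / (n + 1) :=
      div_nonneg (mul_nonneg (sq_nonneg k) (by linarith)) (by linarith)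
    linarith
  rw [div_mul_eq_mul_div (1 / 2 * (1 - k)), div_mul_eq_mul_div (1 / 2 * (1 + k)), ← add_div,
    div_eq_iff hD.ne']
  field_simp
  ring
end

section
/- Fix n ≥ 2, k ∈ (0,1), θ > 0, and let Y_1,…,Y_n be i.i.d. uniform on [θ(1−k), θ(1+k)]. A regular conditional distribution of S_1 = Y_(n) given S_2 = Y_(1)/Y_(n) = s₂ is Pareto(−n, [θ(1−k)/s₂, θ(1+k)]), i.e. for almost every value s₂ of S_2 the conditional law of Y_(n) has density proportional to t^{n−1} on the interval [θ(1−k)/s₂, θ(1+k)]. -/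
open MeasureTheory

/-- The truncated Pareto distribution `Pareto(α, [a,b])`: the measure on `ℝ` with density
`t ↦ (α/(a^(-α) - b^(-α))) t^(-α-1)` on `[a, b]` and `0` elsewhere. -/
noncomputable def paretoTrunc (α a b : ℝ) : Measure ℝ :=
  volume.withDensity fun t =>
    ENNReal.ofReal
      ((Set.Icc a b).indicator (fun t => α / (a ^ (-α) - b ^ (-α)) * t ^ (-α - 1)) t)

section

open Set
open scoped Pointwise

variable {ι : Type*}

/-- The range ratio `min y / max y` of a finite family. -/
noncomputable def rangeRatio (y : ι → ℝ) : ℝ := (⨅ i, y i) / (⨆ i, y i)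

/-- The half-open cube `(0, b]^ι`. -/
def posCube (ι : Type*) (b : ℝ) : Set (ι → ℝ) := univ.pi fun _ => Ioc 0 b

/-- The measure on `(0, b]` with density `n t^(n-1)`. -/
noncomputable def powMeasure (n : ℕ) (b : ℝ) : Measure ℝ :=
  (volume.restrict (Ioc 0 b)).withDensity fun t => ENNReal.ofReal (n * t ^ (n - 1))

lemma mem_posCube {b : ℝ} {y : ι → ℝ} : y ∈ posCube ι b ↔ ∀ i, 0 < y i ∧ y i ≤ b := by
  simp [posCube]

lemma rangeRatio_smul {c : ℝ} (hc : 0 < c) (y : ι → ℝ) :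
    rangeRatio (c • y) = rangeRatio y := by
  simp only [rangeRatio, Pi.smul_apply, smul_eq_mul]
  rw [← Real.mul_iInf_of_nonneg hc.le, ← Real.mul_iSup_of_nonneg hc.le,
    mul_div_mul_left _ _ hc.ne']

variable [Fintype ι]

lemma measurable_iSup_coord : Measurable fun y : ι → ℝ => ⨆ i, y i :=
  Measurable.iSup fun i => measurable_pi_apply i

lemma measurable_rangeRatio : Measurable (rangeRatio : (ι → ℝ) → ℝ) :=
  (Measurable.iInf fun i => measurable_pi_apply i).div measurable_iSup_coord

lemma measurableSet_posCube (b : ℝ) : MeasurableSet (posCube ι b) :=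
  MeasurableSet.univ_pi fun _ => measurableSet_Ioc

lemma volume_posCube_ne_top (b : ℝ) : volume (posCube ι b) ≠ ⊤ := by
  simp [posCube, volume_pi_pi, ENNReal.pow_eq_top_iff]

lemma volume_posCube_inter_rangeRatio {c : ℝ} (hc : 0 < c) (B : Set ℝ) :
    volume (posCube ι c ∩ rangeRatio ⁻¹' B) =
      ENNReal.ofReal (c ^ Fintype.card ι) * volume (posCube ι 1 ∩ rangeRatio ⁻¹' B) := by
  have h : posCube ι c ∩ rangeRatio ⁻¹' B = c • (posCube ι 1 ∩ rangeRatio ⁻¹' B) := by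
    ext y
    rw [mem_smul_set_iff_inv_smul_mem₀ hc.ne']
    simp only [mem_inter_iff, mem_posCube, mem_preimage, rangeRatio_smul (inv_pos.2 hc),
      Pi.smul_apply, smul_eq_mul, inv_mul_le_one₀ hc, inv_pos, hc, mul_pos_iff_of_pos_left]
  rw [h, Measure.addHaar_smul, Module.finrank_fintype_fun_eq_card, abs_of_pos (pow_pos hc _)]

lemma powMeasure_Ioc {n : ℕ} (hn : n ≠ 0) {b u v : ℝ} (hu : 0 ≤ u) (huv : u ≤ v) (hv : v ≤ b) :
    powMeasure n b (Ioc u v) = ENNReal.ofReal (v ^ n - u ^ n) := by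
  rw [powMeasure, withDensity_apply _ measurableSet_Ioc, Measure.restrict_restrict
    measurableSet_Ioc, inter_eq_left.2 (Ioc_subset_Ioc hu hv)]
  have hc : Continuous fun t : ℝ => (n : ℝ) * t ^ (n - 1) := by fun_prop
  rw [← ofReal_integral_eq_lintegral_ofReal (hc.integrableOn_Ioc)]
  · rw [← intervalIntegral.integral_of_le huv, intervalIntegral.integral_const_mul, integral_pow,
      Nat.sub_add_cancel (Nat.one_le_iff_ne_zero.2 hn), Nat.cast_sub (Nat.one_le_iff_ne_zero.2 hn)]
    congr 1
    have : (n : ℝ) ≠ 0 := by exact_mod_cast hn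
    rw [Nat.cast_one, sub_add_cancel]
    field_simp
  · filter_upwards [ae_restrict_mem measurableSet_Ioc] with t ht
    have := hu.trans ht.1.le
    positivity

lemma powMeasure_inter_Ioc {n : ℕ} (b : ℝ) {S : Set ℝ} (hS : MeasurableSet S) :
    powMeasure n b (S ∩ Ioc 0 b) = powMeasure n b S := by
  rw [powMeasure, withDensity_apply _ hS, withDensity_apply _ (hS.inter measurableSet_Ioc),
    Measure.restrict_restrict hS, Measure.restrict_restrict (hS.inter measurableSet_Ioc),
    inter_assoc, inter_self]

lemma powMeasure_Iic {n : ℕ} (hn : n ≠ 0) {b : ℝ} (hb : 0 < b) (t : ℝ) :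
    powMeasure n b (Iic t) = ENNReal.ofReal ((max 0 (min t b)) ^ n) := by
  rw [← powMeasure_inter_Ioc _ measurableSet_Iic]
  have : Iic t ∩ Ioc 0 b = Ioc 0 (max 0 (min t b)) := by
    ext x
    simp only [mem_inter_iff, mem_Iic, mem_Ioc, le_max_iff, le_min_iff]
    grind
  rw [this, powMeasure_Ioc hn le_rfl (le_max_left _ _) (by simp [hb.le]), zero_pow hn, sub_zero]

lemma isFiniteMeasure_powMeasure {n : ℕ} (hn : n ≠ 0) {b : ℝ} (hb : 0 < b) :
    IsFiniteMeasure (powMeasure n b) := by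
  constructor
  rw [← powMeasure_inter_Ioc _ MeasurableSet.univ, univ_inter, powMeasure_Ioc hn le_rfl hb.le le_rfl]
  exact ENNReal.ofReal_lt_top

lemma map_rangeRatio_iSup [Nonempty ι] {b : ℝ} (hb : 0 < b) :
    (volume.restrict (posCube ι b)).map (fun y => (rangeRatio y, ⨆ i, y i)) =
      ((volume.restrict (posCube ι 1)).map rangeRatio).prod (powMeasure (Fintype.card ι) b) := by
  have hn : Fintype.card ι ≠ 0 := Fintype.card_ne_zero
  have := isFiniteMeasure_powMeasure hn hb
  have h1 : IsFiniteMeasure ((volume : Measure (ι → ℝ)).restrict (posCube ι 1)) :=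
    isFiniteMeasure_restrict.2 (volume_posCube_ne_top 1)
  have h2 : IsFiniteMeasure ((volume : Measure (ι → ℝ)).restrict (posCube ι b)) :=
    isFiniteMeasure_restrict.2 (volume_posCube_ne_top b)
  have hm := measurable_iSup_coord (ι := ι)
  have hr := measurable_rangeRatio (ι := ι)
  refine (Measure.prod_eq fun B A hB hA => ?_).symm
  rw [Measure.map_apply (hr.prodMk hm) (hB.prod hA), Measure.map_apply hr hB,
    Measure.restrict_apply (hr hB), inter_comm _ (posCube ι 1)]
  have key : ((volume.restrict (posCube ι b)).restrict (rangeRatio ⁻¹' B)).map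
        (fun y : ι → ℝ => ⨆ i, y i) =
      volume (posCube ι 1 ∩ rangeRatio ⁻¹' B) • powMeasure (Fintype.card ι) b := by
    refine Measure.ext_of_Iic _ _ fun t => ?_
    rw [Measure.map_apply hm measurableSet_Iic, Measure.restrict_apply (hm measurableSet_Iic),
      Measure.restrict_apply ((hm measurableSet_Iic).inter (hr hB)), Measure.smul_apply,
      powMeasure_Iic hn hb, smul_eq_mul, mul_comm]
    have hset : (fun y : ι → ℝ => ⨆ i, y i) ⁻¹' Iic t ∩ rangeRatio ⁻¹' B ∩ posCube ι b =
        posCube ι (min t b) ∩ rangeRatio ⁻¹' B := by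
      ext y
      have : (⨆ i, y i) ≤ t ↔ ∀ i, y i ≤ t := ciSup_le_iff (finite_range y).bddAbove
      simp only [mem_inter_iff, mem_preimage, mem_Iic, mem_posCube, this, le_min_iff]
      grind
    rw [hset]
    rcases le_or_gt (min t b) 0 with h | h
    · have : posCube ι (min t b) = ∅ := by
        refine eq_empty_of_forall_notMem fun y hy => ?_
        have := mem_posCube.1 hy (Classical.arbitrary ι)
        linarith
      simp [this, max_eq_left h, hn]
    · rw [volume_posCube_inter_rangeRatio h, max_eq_right h.le]
  have := congrArg (fun μ : Measure ℝ => μ A) key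
  simp only [Measure.smul_apply, smul_eq_mul] at this
  rw [← this, Measure.map_apply hm hA, Measure.restrict_apply (hm hA), inter_comm]
  rfl

lemma pi_unifIcc (a b : ℝ) (hab : a < b) :
    (Measure.pi fun _ : ι => unifIcc a b) =
      (ENNReal.ofReal (b - a))⁻¹ ^ Fintype.card ι •
        (volume : Measure (ι → ℝ)).restrict (univ.pi fun _ => Icc a b) := by
  have hK : (ENNReal.ofReal (b - a))⁻¹ ≠ ⊤ := by simpa using hab
  have : IsFiniteMeasure (unifIcc a b) := by
    constructor
    simp [unifIcc, ENNReal.mul_lt_top, hK.lt_top]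
  refine Measure.pi_eq fun s hs => ?_
  rw [volume_pi, Measure.restrict_pi_pi, Measure.smul_apply, Measure.pi_pi]
  simp [unifIcc, Finset.prod_mul_distrib]

lemma univ_pi_Icc_eq [Nonempty ι] {a b : ℝ} (ha : 0 < a) :
    (univ.pi fun _ : ι => Icc a b) =
      (fun y => (rangeRatio y, ⨆ i, y i)) ⁻¹' {p | a ≤ p.1 * p.2} ∩ posCube ι b := by
  ext y
  simp only [mem_pi, mem_univ, forall_true_left, mem_Icc, mem_inter_iff, mem_preimage,
    mem_ofPred_eq, mem_posCube]
  have hiff : a ≤ (⨅ i, y i) ↔ ∀ i, a ≤ y i := le_ciInf_iff (finite_range y).bddBelow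
  have hpos (h : ∀ i, 0 < y i) : rangeRatio y * (⨆ i, y i) = ⨅ i, y i :=
    div_mul_cancel₀ _ ((h (Classical.arbitrary ι)).trans_le
      (le_ciSup (finite_range y).bddAbove _)).ne'
  constructor
  · intro h
    have h0 : ∀ i, 0 < y i := fun i => ha.trans_le (h i).1
    rw [hpos h0, hiff]
    exact ⟨fun i => (h i).1, fun i => ⟨h0 i, (h i).2⟩⟩
  · rintro ⟨h, h'⟩
    rw [hpos fun i => (h' i).1, hiff] at h
    exact fun i => ⟨h i, (h' i).2⟩

lemma ae_map_rangeRatio_pos [Nonempty ι] :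
    ∀ᵐ r ∂((volume.restrict (posCube ι 1)).map rangeRatio), 0 < r := by
  rw [ae_map_iff measurable_rangeRatio.aemeasurable measurableSet_Ioi]
  filter_upwards [ae_restrict_mem (measurableSet_posCube 1)] with y hy
  rw [mem_posCube] at hy
  obtain ⟨i, hi⟩ := exists_eq_ciInf_of_finite (f := y)
  exact div_pos (hi ▸ (hy i).1) ((hy i).1.trans_le (le_ciSup (finite_range y).bddAbove _))

lemma lintegral_pi_unifIcc [Nonempty ι] {a b : ℝ} (ha : 0 < a) (hab : a < b)
    {G : ℝ × ℝ → ENNReal} (hG : Measurable G) :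
    ∫⁻ y, G (rangeRatio y, ⨆ i, y i) ∂(Measure.pi fun _ : ι => unifIcc a b) =
      (ENNReal.ofReal (b - a))⁻¹ ^ Fintype.card ι *
        ∫⁻ r, ∫⁻ t in Ici (a / r), G (r, t) ∂(powMeasure (Fintype.card ι) b)
          ∂((volume.restrict (posCube ι 1)).map rangeRatio) := by
  have := isFiniteMeasure_powMeasure (Fintype.card_ne_zero (α := ι)) (ha.trans hab)
  have hm := measurable_iSup_coord (ι := ι)
  have hr := measurable_rangeRatio (ι := ι)
  have hT : MeasurableSet {p : ℝ × ℝ | a ≤ p.1 * p.2} :=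
    measurableSet_le measurable_const (by fun_prop)
  rw [pi_unifIcc a b hab, lintegral_smul_measure, smul_eq_mul, univ_pi_Icc_eq ha,
    ← Measure.restrict_restrict ((hr.prodMk hm) hT),
    ← setLIntegral_map hT hG (hr.prodMk hm), map_rangeRatio_iSup (ha.trans hab),
    ← lintegral_indicator hT, lintegral_prod _ (hG.indicator hT).aemeasurable]
  congr 1
  refine lintegral_congr_ae ?_
  filter_upwards [ae_map_rangeRatio_pos] with r hr0
  rw [← lintegral_indicator measurableSet_Ici]
  refine lintegral_congr fun t => ?_
  simp only [indicator, mem_ofPred_eq, mem_Ici, div_le_iff₀' hr0]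

lemma powMeasure_Ici {n : ℕ} {a b : ℝ} (ha : 0 < a) :
    powMeasure n b (Ici a) = powMeasure n b (Ioc a b) := by
  have hac : powMeasure n b ≪ volume :=
    (withDensity_absolutelyContinuous _ _).trans Measure.absolutelyContinuous_restrict
  rw [← measure_congr (hac.ae_eq Ioi_ae_eq_Ici), ← powMeasure_inter_Ioc b measurableSet_Ioi]
  congr 1
  ext x
  simp only [mem_inter_iff, mem_Ioi, mem_Ioc]
  grind

lemma paretoTrunc_neg_natCast_apply {n : ℕ} {a b : ℝ} (ha : 0 < a)
    (hab : a < b) {A : Set ℝ} (hA : MeasurableSet A) :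
    paretoTrunc (-(n : ℝ)) a b A =
      ENNReal.ofReal (b ^ n - a ^ n)⁻¹ * powMeasure n b (A ∩ Ici a) := by
  have hS : MeasurableSet (A ∩ Ici a) := hA.inter measurableSet_Ici
  have hset : A ∩ Ici a ∩ Ioc 0 b = A ∩ Icc a b := by
    ext x
    simp only [mem_inter_iff, mem_Ici, mem_Ioc, mem_Icc]
    grind
  rw [paretoTrunc, withDensity_apply _ hA, powMeasure, withDensity_apply _ hS,
    Measure.restrict_restrict hS, hset, ← lintegral_const_mul' _ _ ENNReal.ofReal_ne_top,
    inter_comm A, ← Measure.restrict_restrict measurableSet_Icc,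
    ← lintegral_indicator measurableSet_Icc]
  refine lintegral_congr fun t => ?_
  by_cases ht : t ∈ Icc a b
  · have hpow : 0 ≤ b ^ n - a ^ n := sub_nonneg.2 (pow_le_pow_left₀ ha.le hab.le n)
    rw [indicator_of_mem ht, indicator_of_mem ht, ← ENNReal.ofReal_mul (inv_nonneg.2 hpow)]
    congr 1
    rcases n.eq_zero_or_pos with rfl | hn
    · simp
    · have ht' : t ^ (-(-(n : ℝ)) - 1) = t ^ (n - 1) := by
        rw [neg_neg, ← Real.rpow_natCast, Nat.cast_sub hn, Nat.cast_one]
      rw [ht', neg_neg, Real.rpow_natCast, Real.rpow_natCast, ← neg_sub (b ^ n), neg_div_neg_eq,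
        div_eq_inv_mul, mul_assoc]
  · simp [ht]

lemma paretoTrunc_mul_powMeasure_Ici {n : ℕ} (hn : n ≠ 0) {a b : ℝ} (ha : 0 < a)
    {A : Set ℝ} (hA : MeasurableSet A) :
    paretoTrunc (-(n : ℝ)) a b A * powMeasure n b (Ici a) = powMeasure n b (A ∩ Ici a) := by
  rcases lt_or_ge a b with hab | hab
  · have hpow : 0 < b ^ n - a ^ n := sub_pos.2 (pow_lt_pow_left₀ hab ha.le hn)
    rw [paretoTrunc_neg_natCast_apply ha hab hA, powMeasure_Ici ha,
      powMeasure_Ioc hn ha.le hab.le le_rfl, mul_right_comm,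
      ← ENNReal.ofReal_mul (inv_nonneg.2 hpow.le), inv_mul_cancel₀ hpow.ne',
      ENNReal.ofReal_one, one_mul]
  · have h0 : powMeasure n b (Ici a) = 0 := by
      rw [powMeasure_Ici ha, Ioc_eq_empty hab.not_gt, measure_empty]
    rw [h0, mul_zero, measure_mono_null inter_subset_right h0]

lemma measurable_paretoTrunc_apply (α b : ℝ) {A : Set ℝ} (hA : MeasurableSet A) :
    Measurable fun a => paretoTrunc α a b A := by
  simp only [paretoTrunc, withDensity_apply _ hA]
  refine Measurable.lintegral_prod_right' (f := fun p : ℝ × ℝ => ENNReal.ofReal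
    ((Icc p.1 b).indicator (fun t => α / (p.1 ^ (-α) - b ^ (-α)) * t ^ (-α - 1)) p.2)) ?_
  have hS : MeasurableSet {p : ℝ × ℝ | p.1 ≤ p.2 ∧ p.2 ≤ b} :=
    (measurableSet_le measurable_fst measurable_snd).inter
      (measurableSet_le measurable_snd measurable_const)
  have hf : Measurable fun p : ℝ × ℝ => α / (p.1 ^ (-α) - b ^ (-α)) * p.2 ^ (-α - 1) := by
    fun_prop
  exact (hf.indicator hS).ennreal_ofReal

theorem measure_pi_unifIcc_eq_lintegral_paretoTrunc [Nonempty ι] {a b : ℝ} (ha : 0 < a)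
    (hab : a < b) {A B : Set ℝ} (hA : MeasurableSet A) (hB : MeasurableSet B) :
    (Measure.pi fun _ : ι => unifIcc a b)
        ((fun y => ⨆ i, y i) ⁻¹' A ∩ rangeRatio ⁻¹' B) =
      ∫⁻ y in rangeRatio ⁻¹' B, paretoTrunc (-(Fintype.card ι : ℝ)) (a / rangeRatio y) b A
        ∂(Measure.pi fun _ : ι => unifIcc a b) := by
  have hm := measurable_iSup_coord (ι := ι)
  have hr := measurable_rangeRatio (ι := ι)
  have hP : Measurable fun r : ℝ => paretoTrunc (-(Fintype.card ι : ℝ)) (a / r) b A :=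
    (measurable_paretoTrunc_apply _ b hA).comp (measurable_const.div measurable_id)
  have h1 := lintegral_pi_unifIcc (ι := ι) ha hab
    (G := (B ×ˢ A).indicator 1) (measurable_one.indicator (hB.prod hA))
  have h2 := lintegral_pi_unifIcc (ι := ι) ha hab
    (G := fun p => B.indicator (fun r => paretoTrunc (-(Fintype.card ι : ℝ)) (a / r) b A) p.1)
    ((hP.indicator hB).comp measurable_fst)
  rw [← lintegral_indicator_one ((hm hA).inter (hr hB)), ← lintegral_indicator (hr hB)]
  refine Eq.trans ?_ (h1.trans (Eq.trans ?_ h2.symm))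
  · rw [inter_comm]
    rfl
  congr 1
  refine lintegral_congr_ae ?_
  filter_upwards [ae_map_rangeRatio_pos] with r hr0
  rw [lintegral_const, Measure.restrict_apply_univ]
  by_cases hrB : r ∈ B
  · rw [indicator_of_mem hrB, paretoTrunc_mul_powMeasure_Ici Fintype.card_ne_zero
      (div_pos ha hr0) hA, ← Measure.restrict_apply hA, ← lintegral_indicator_one hA]
    refine lintegral_congr fun t => ?_
    by_cases ht : t ∈ A <;> simp [hrB, ht]
  · simp [indicator, hrB]

end

/-- For `Y_1, …, Y_n` i.i.d. uniform on `[θ(1-k), θ(1+k)]`, the kernel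
`s₂ ↦ Pareto(-n, [θ(1-k)/s₂, θ(1+k)])` is a regular conditional distribution of
`S₁ = Y_(n)` given `S₂ = Y_(1)/Y_(n)` (a disintegration of the joint law), i.e. for
almost every `s₂` the conditional law of `Y_(n)` has density proportional to `t^(n-1)`
on `[θ(1-k)/s₂, θ(1+k)]`. -/
theorem stmt_7 (n : ℕ) (hn : 2 ≤ n) (k : ℝ) (hk : k ∈ Set.Ioo (0:ℝ) 1)
    (θ : ℝ) (hθ : 0 < θ) :
    ∀ A : Set ℝ, MeasurableSet A → ∀ B : Set ℝ, MeasurableSet B →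
      (Measure.pi fun _ : Fin n => unifIcc (θ * (1 - k)) (θ * (1 + k)))
          ((fun y : Fin n → ℝ => ⨆ i, y i) ⁻¹' A
            ∩ (fun y : Fin n → ℝ => (⨅ i, y i) / (⨆ i, y i)) ⁻¹' B)
        = ∫⁻ y in (fun y : Fin n → ℝ => (⨅ i, y i) / (⨆ i, y i)) ⁻¹' B,
            paretoTrunc (-(n : ℝ)) (θ * (1 - k) / ((⨅ i, y i) / (⨆ i, y i))) (θ * (1 + k)) A
            ∂(Measure.pi fun _ : Fin n => unifIcc (θ * (1 - k)) (θ * (1 + k))) := by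
  intro A hA B hB
  have : Nonempty (Fin n) := ⟨⟨0, by omega⟩⟩
  have h := measure_pi_unifIcc_eq_lintegral_paretoTrunc (ι := Fin n)
    (mul_pos hθ (sub_pos.2 hk.2)) (mul_lt_mul_of_pos_left (by linarith [hk.1]) hθ :
      θ * (1 - k) < θ * (1 + k)) hA hB
  rw [Fintype.card_fin] at h
  exact h
end

section
/- Let n ≥ 2, k ∈ (0,1), and let y ∈ (0,∞)ⁿ with y_(1) ≤ y_(n) and y_(n)/(1+k) < y_(1)/(1−k). With s₂ = y_(1)/y_(n), φ(s₂) = ((n+1)/n)·((1+k)^n − ((1−k)/s₂)^n)/((1+k)^{n+1} − ((1−k)/s₂)^{n+1}), θ̂_ML = y_(n)/(1+k), θ̂_MU = y_(1)/(1−k), and b_* = θ̂_MU/θ̂_ML, the following algebraic identity holds: φ(s₂)·y_(n) = ((n+1)/n) · (1 − b_*^{−n})/(1 − b_*^{−n−1}) · θ̂_ML. In other words, the conditionally unbiased estimator T = φ(S_2)S_1 coincides with the generalized Bayes estimator θ̂_B2 obtained from the improper prior θ^{−2}. -/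
open MeasureTheory

/-- `φ(s₂) = ((n+1)/n) ((1+k)^n − ((1−k)/s₂)^n) / ((1+k)^(n+1) − ((1−k)/s₂)^(n+1))`. -/
noncomputable def phi (n : ℕ) (k s₂ : ℝ) : ℝ :=
  ((n + 1 : ℝ) / n) * ((1 + k) ^ n - ((1 - k) / s₂) ^ n)
    / ((1 + k) ^ (n + 1) - ((1 - k) / s₂) ^ (n + 1))

/-- Factoring `(1 + k) ^ n` out of `φ` when `(1 - k) / s₂ = (1 + k) * b⁻¹`. -/
lemma phi_eq_of_div_eq {n : ℕ} {k s₂ b : ℝ} (hk : 1 + k ≠ 0)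
    (hb : (1 - k) / s₂ = (1 + k) * b⁻¹) :
    phi n k s₂ = ((n + 1 : ℝ) / n) * (1 - b ^ (-(n : ℤ))) / (1 - b ^ (-(n : ℤ) - 1))
      / (1 + k) := by
  have hz : b ^ (-(n : ℤ)) = b⁻¹ ^ n := by simp
  have hz' : b ^ (-(n : ℤ) - 1) = b⁻¹ ^ (n + 1) := by
    rw [show -(n : ℤ) - 1 = -((n + 1 : ℕ) : ℤ) by push_cast; ring, zpow_neg, zpow_natCast, inv_pow]
  rw [phi, hb, mul_pow, mul_pow, hz, hz', div_div,
    ← mul_div_mul_left _ ((1 - b⁻¹ ^ (n + 1)) * (1 + k))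
    (pow_ne_zero n hk)]
  congr 1 <;> ring

/-- With `s₂ = y_(1)/y_(n)`, `θ̂_ML = y_(n)/(1+k)`, `θ̂_MU = y_(1)/(1-k)` and
`b_* = θ̂_MU/θ̂_ML`, one has `φ(s₂) y_(n) = ((n+1)/n) (1 - b_*^(-n))/(1 - b_*^(-n-1)) θ̂_ML`:
the conditionally unbiased estimator `T = φ(S₂) S₁` coincides with the generalized Bayes
estimator for the improper prior `θ^(-2)`. -/
theorem stmt_9 (n : ℕ) (hn : 2 ≤ n) (k : ℝ) (hk : k ∈ Set.Ioo (0:ℝ) 1)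
    (y : Fin n → ℝ) (hy : ∀ i, 0 < y i)
    (hminmax : (⨅ i, y i) ≤ ⨆ i, y i)
    (hfeas : (⨆ i, y i) / (1 + k) < (⨅ i, y i) / (1 - k)) :
    phi n k ((⨅ i, y i) / (⨆ i, y i)) * (⨆ i, y i)
      = ((n + 1 : ℝ) / n)
        * (1 - (((⨅ i, y i) / (1 - k)) / ((⨆ i, y i) / (1 + k))) ^ (-(n : ℤ)))
        / (1 - (((⨅ i, y i) / (1 - k)) / ((⨆ i, y i) / (1 + k))) ^ (-(n : ℤ) - 1))
        * ((⨆ i, y i) / (1 + k)) := by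
  have hk' : 1 + k ≠ 0 := by linarith [hk.1]
  rw [phi_eq_of_div_eq hk' (b := ((⨅ i, y i) / (1 - k)) / ((⨆ i, y i) / (1 + k)))
    (by field_simp)]
  ring
end

section
/- Let n ≥ 1 and 0 < a < b, and let Θ have the truncated Pareto distribution Pareto(n, [a,b]). Then, with b_* = b/a, E[Θ^{−1}]/E[Θ^{−2}] = ((n+2)/(n+1)) · (1 − b_*^{−(n+1)})/(1 − b_*^{−(n+2)}) · a. In other words, the optimal invariant estimate θ̂_OPT = E[Θ^{−1}]/E[Θ^{−2}] computed from the fiducial distribution Pareto(n, [θ̂_ML, θ̂_MU]) coincides with the generalized Bayes estimator θ̂_Bp for p = 3 (index α = n+2). -/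
open MeasureTheory

theorem integral_paretoTrunc {α a b : ℝ} (hα : 0 < α) (ha : 0 < a) (hab : a < b) (g : ℝ → ℝ) :
    ∫ t, g t ∂(paretoTrunc α a b)
      = α / (a ^ (-α) - b ^ (-α)) * ∫ t in a..b, t ^ (-α - 1) * g t := by
  have hC : 0 ≤ α / (a ^ (-α) - b ^ (-α)) :=
    div_nonneg hα.le (sub_nonneg.2 (Real.rpow_le_rpow_of_nonpos ha hab.le (neg_nonpos.2 hα.le)))
  have hmeas : Measurable
      ((Set.Icc a b).indicator fun t => α / (a ^ (-α) - b ^ (-α)) * t ^ (-α - 1)) :=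
    (by fun_prop : Measurable fun t : ℝ => α / (a ^ (-α) - b ^ (-α)) * t ^ (-α - 1)).indicator
      measurableSet_Icc
  have hnonneg (t : ℝ) :
      0 ≤ (Set.Icc a b).indicator (fun t => α / (a ^ (-α) - b ^ (-α)) * t ^ (-α - 1)) t :=
    Set.indicator_nonneg
      (fun t ht => mul_nonneg hC (Real.rpow_nonneg (ha.le.trans ht.1) _)) t
  rw [paretoTrunc, integral_withDensity_eq_integral_toReal_smul hmeas.ennreal_ofReal
    (Filter.Eventually.of_forall fun _ => ENNReal.ofReal_lt_top),
    ← intervalIntegral.integral_const_mul, intervalIntegral.integral_of_le hab.le,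
    ← integral_Icc_eq_integral_Ioc, ← integral_indicator measurableSet_Icc]
  congr 1 with t
  rw [ENNReal.toReal_ofReal (hnonneg t)]
  by_cases ht : t ∈ Set.Icc a b <;> simp [ht, mul_assoc]

theorem integral_rpow_paretoTrunc {α a b s : ℝ} (hα : 0 < α) (ha : 0 < a) (hab : a < b)
    (hs : s ≠ α) :
    ∫ t, t ^ s ∂(paretoTrunc α a b)
      = α / (a ^ (-α) - b ^ (-α)) * ((a ^ (s - α) - b ^ (s - α)) / (α - s)) := by
  have hpos {t : ℝ} (ht : t ∈ Set.uIcc a b) : 0 < t := by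
    rw [Set.uIcc_of_le hab.le] at ht
    exact ha.trans_le ht.1
  have hcongr : ∫ t in a..b, t ^ (-α - 1) * t ^ s = ∫ t in a..b, t ^ (s - α - 1) :=
    intervalIntegral.integral_congr fun t ht => by
      simp only [← Real.rpow_add (hpos ht)]
      ring_nf
  have hne : s - α ≠ 0 := sub_ne_zero.2 hs
  rw [integral_paretoTrunc hα ha hab, hcongr, integral_rpow (Or.inr
    ⟨fun h => hne (by linarith), fun h => (hpos h).false⟩), sub_add_cancel,
    ← neg_sub s α, div_neg, ← neg_div, neg_sub]

theorem one_sub_div_rpow_neg {a b : ℝ} (ha : 0 < a) (hb : 0 < b) (r : ℝ) :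
    1 - (b / a) ^ (-r) = a ^ r * (a ^ (-r) - b ^ (-r)) := by
  rw [Real.div_rpow hb.le ha.le, mul_sub, ← Real.rpow_add ha, add_neg_cancel, Real.rpow_zero,
    Real.rpow_neg ha.le, div_inv_eq_mul, mul_comm]

/-- For `Θ ~ Pareto(n, [a,b])` with `n ≥ 1`, `0 < a < b` and `b_* = b/a`,
`E[Θ⁻¹]/E[Θ⁻²] = ((n+2)/(n+1)) (1 - b_*^(-(n+1)))/(1 - b_*^(-(n+2))) a`: the optimal
invariant estimate coincides with the generalized Bayes estimator for `p = 3`. -/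
theorem stmt_15 (n : ℕ) (hn : 1 ≤ n) (a b : ℝ) (ha : 0 < a) (hab : a < b) :
    (∫ t : ℝ, t⁻¹ ∂(paretoTrunc (n : ℝ) a b)) / (∫ t : ℝ, (t⁻¹) ^ 2 ∂(paretoTrunc (n : ℝ) a b))
      = (((n : ℝ) + 2) / ((n : ℝ) + 1))
        * (1 - (b / a) ^ (-((n : ℝ) + 1))) / (1 - (b / a) ^ (-((n : ℝ) + 2))) * a := by
  have hb : 0 < b := ha.trans hab
  have hn0 : (0 : ℝ) < n := by exact_mod_cast hn
  have hlt {r : ℝ} (hr : 0 < r) : a ^ (-r) - b ^ (-r) ≠ 0 :=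
    (sub_pos.2 (Real.rpow_lt_rpow_of_neg ha hab (neg_lt_zero.2 hr))).ne'
  have hmean : ∫ t : ℝ, t⁻¹ ∂(paretoTrunc (n : ℝ) a b)
      = ∫ t : ℝ, t ^ (-1 : ℝ) ∂(paretoTrunc (n : ℝ) a b) := by
    simp only [Real.rpow_neg_one]
  have hsq : ∫ t : ℝ, (t⁻¹) ^ 2 ∂(paretoTrunc (n : ℝ) a b)
      = ∫ t : ℝ, t ^ (-2 : ℝ) ∂(paretoTrunc (n : ℝ) a b) := by
    congr 1 with t
    rw [inv_pow, ← zpow_natCast, ← zpow_neg, ← Real.rpow_intCast]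
    norm_num
  rw [hmean, hsq, integral_rpow_paretoTrunc hn0 ha hab (by linarith),
    integral_rpow_paretoTrunc hn0 ha hab (by linarith), one_sub_div_rpow_neg ha hb,
    one_sub_div_rpow_neg ha hb,
    show (-1 : ℝ) - n = -((n : ℝ) + 1) by ring, show (-2 : ℝ) - n = -((n : ℝ) + 2) by ring,
    show a ^ ((n : ℝ) + 2) = a ^ ((n : ℝ) + 1) * a by
      rw [← Real.rpow_add_one ha.ne']; ring_nf]
  have h0 := hlt hn0
  have h1 := hlt (show (0 : ℝ) < n + 1 by linarith)
  have h2 := hlt (show (0 : ℝ) < n + 2 by linarith)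
  have ha1 := (Real.rpow_pos_of_pos ha ((n : ℝ) + 1)).ne'
  have hn1 : (n : ℝ) + 1 ≠ 0 := by linarith
  have hn2 : (n : ℝ) + 2 ≠ 0 := by linarith
  rw [sub_neg_eq_add, sub_neg_eq_add]
  generalize a ^ (-(n : ℝ)) - b ^ (-(n : ℝ)) = x at *
  generalize a ^ (-((n : ℝ) + 1)) - b ^ (-((n : ℝ) + 1)) = y at *
  generalize a ^ (-((n : ℝ) + 2)) - b ^ (-((n : ℝ) + 2)) = z at *
  generalize a ^ ((n : ℝ) + 1) = w at *
  field_simp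
end
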